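/- Let X be a measurable space and let Q : ℱ(𝒯(X)) → [0,1] be measurable, weakly averaging, affine, and limit-preserving, with associated probability measure ν_Q on 𝒯(X) given by ν_Q(E) = Q(χ_E). Then for every measurable set S ⊆ X, Q(ev_{χ_S}) = ∫_{𝒯(X)} G(χ_S) dν_Q(G); equivalently, the probability measure associated to the functional μ_X(Q) : f ↦ Q(ev_f) is the Giry multiplication (join) applied to the pushforward of ν_Q along the map G ↦ ν_G, i.e. ν_{μ_X(Q)}(S) = ∫ ν_G(S) dν_Q(G). -/

import Mathlib

open MeasureTheory Set Filter

/-- `f : Z → ℝ` represents an element of `ℱ(Z)`: a measurable function with values in `[0,1]`. -/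
def IsUF {Z : Type*} [MeasurableSpace Z] (f : Z → ℝ) : Prop :=
  Measurable f ∧ ∀ z, f z ∈ Set.Icc (0 : ℝ) 1

/-- `ℱ(Z)`, the space of measurable functions `Z → [0,1]`.  As a subtype of `Z → ℝ`
(with its product σ-algebra) it carries the σ-algebra generated by the point
evaluation maps `f ↦ f z`, `z : Z`. -/
abbrev UF (Z : Type*) [MeasurableSpace Z] : Type _ := {f : Z → ℝ // IsUF f}

/-- The constant function with value `c ∈ [0,1]`, as an element of `ℱ(Z)`. -/
def constUF {Z : Type*} [MeasurableSpace Z] (c : ℝ) (hc : c ∈ Set.Icc (0 : ℝ) 1) : UF Z :=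
  ⟨fun _ => c, measurable_const, fun _ => hc⟩

/-- The pointwise convex combination `α·f + (1-α)·g` of `f, g ∈ ℱ(Z)`. -/
noncomputable def convComb {Z : Type*} [MeasurableSpace Z] (α : ℝ) (hα : α ∈ Set.Icc (0 : ℝ) 1)
    (f g : UF Z) : UF Z :=
  ⟨fun z => α * f.1 z + (1 - α) * g.1 z, by
    refine ⟨(f.2.1.const_mul α).add (g.2.1.const_mul (1 - α)), fun z => ⟨?_, ?_⟩⟩ <;> dsimp only <;>
      nlinarith [hα.1, hα.2, (f.2.2 z).1, (f.2.2 z).2, (g.2.2 z).1, (g.2.2 z).2]⟩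

/-- The characteristic function `χ_S ∈ ℱ(Z)` of a measurable set `S`. -/
noncomputable def chi {Z : Type*} [MeasurableSpace Z] (S : Set Z) (hS : MeasurableSet S) : UF Z :=
  ⟨S.indicator fun _ => (1 : ℝ), by
    refine ⟨measurable_const.indicator hS, fun z => ?_⟩
    by_cases h : z ∈ S <;> simp [h]⟩

/-- A functional `G : ℱ(Z) → [0,1]` is weakly averaging if it sends each constant function
with value `c ∈ [0,1]` to `c`. -/
def WeaklyAveraging {Z : Type*} [MeasurableSpace Z] (G : UF Z → ℝ) : Prop :=
  ∀ (c : ℝ) (hc : c ∈ Set.Icc (0 : ℝ) 1), G (constUF c hc) = c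

/-- A functional `G : ℱ(Z) → [0,1]` is affine if it preserves (pointwise) convex
combinations. -/
def IsAffineFunctional {Z : Type*} [MeasurableSpace Z] (G : UF Z → ℝ) : Prop :=
  ∀ (f g : UF Z) (α : ℝ) (hα : α ∈ Set.Icc (0 : ℝ) 1),
    G (convComb α hα f g) = α * G f + (1 - α) * G g

/-- A functional `G : ℱ(Z) → [0,1]` preserves limits if on each `f ∈ ℱ(Z)` its value is
the supremum of its values on simple (finite range) members of `ℱ(Z)` below `f`. -/
def PreservesLimitsFunctional {Z : Type*} [MeasurableSpace Z] (G : UF Z → ℝ) : Prop :=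
  ∀ f : UF Z, G f = sSup {r : ℝ | ∃ ψ : UF Z,
    (Set.range ψ.1).Finite ∧ (∀ z, ψ.1 z ≤ f.1 z) ∧ G ψ = r}

/-- `𝒯(Z)`: the space of measurable, weakly averaging, affine, limit-preserving
functionals `ℱ(Z) → [0,1]`.  As a subtype of `ℱ(Z) → ℝ` (with its product σ-algebra)
it carries the σ-algebra generated by the evaluation maps `G ↦ G f`, `f ∈ ℱ(Z)`. -/
abbrev TT (Z : Type*) [MeasurableSpace Z] : Type _ :=
  {G : UF Z → ℝ // Measurable G ∧ (∀ f, G f ∈ Set.Icc (0 : ℝ) 1) ∧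
    WeaklyAveraging G ∧ IsAffineFunctional G ∧ PreservesLimitsFunctional G}

/-- For `f ∈ ℱ(X)`, the evaluation map `ev_f : 𝒯(X) → [0,1]`, `G ↦ G(f)`, belongs to
`ℱ(𝒯(X))`: it is measurable and takes values in `[0,1]`. -/
lemma evalUF {X : Type*} [MeasurableSpace X] (f : UF X) :
    IsUF (fun G : TT X => G.1 f) :=
  ⟨(measurable_pi_apply f).comp measurable_subtype_coe, fun G => G.2.2.1 f⟩

section

variable {Z : Type*} [MeasurableSpace Z] {Q : UF Z → ℝ}

lemma UF.integrable (f : UF Z) (ν : Measure Z) [IsProbabilityMeasure ν] : Integrable f.1 ν :=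
  Integrable.of_bound f.2.1.aestronglyMeasurable 1 <| Eventually.of_forall fun z => by
    rw [Real.norm_eq_abs, abs_of_nonneg (f.2.2 z).1]
    exact (f.2.2 z).2

lemma IsAffineFunctional.map_const_mul (hWA : WeaklyAveraging Q) (hAff : IsAffineFunctional Q)
    (f g : UF Z) (c : ℝ) (hc : c ∈ Set.Icc (0 : ℝ) 1) (h : ∀ z, g.1 z = c * f.1 z) :
    Q g = c * Q f := by
  have h0 : (0 : ℝ) ∈ Set.Icc (0 : ℝ) 1 := ⟨le_rfl, zero_le_one⟩
  have key := hAff f (constUF 0 h0) c hc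
  rw [hWA, mul_zero, add_zero] at key
  rw [← key]
  congr 1
  exact Subtype.ext (funext fun z => by simp [h, convComb, constUF])

lemma IsAffineFunctional.map_add (hWA : WeaklyAveraging Q) (hAff : IsAffineFunctional Q)
    (f g k : UF Z) (h : ∀ z, k.1 z = f.1 z + g.1 z) : Q k = Q f + Q g := by
  have hhalf : (1 / 2 : ℝ) ∈ Set.Icc (0 : ℝ) 1 := by constructor <;> norm_num
  have h1 := hAff f g (1 / 2) hhalf
  have h2 := hAff.map_const_mul hWA k (convComb (1 / 2) hhalf f g) (1 / 2) hhalf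
    fun z => by simp only [convComb, h]; ring
  linarith

/-- An affine, weakly averaging functional agrees on simple functions with integration against
its associated measure. -/
lemma IsAffineFunctional.eq_integral_simpleFunc (hQ0 : ∀ g, 0 ≤ Q g)
    (hWA : WeaklyAveraging Q) (hAff : IsAffineFunctional Q)
    (ν : Measure Z) [IsProbabilityMeasure ν]
    (hνQ : ∀ (E : Set Z) (hE : MeasurableSet E), ν E = ENNReal.ofReal (Q (chi E hE)))
    (f : SimpleFunc Z ℝ) : ∀ hf : IsUF f, Q ⟨f, hf⟩ = ∫ z, f z ∂ν := by
  induction f using SimpleFunc.induction with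
  | @const c s hs =>
    intro hf
    have hint : ∀ d : ℝ, ∫ z, s.indicator (fun _ => d) z ∂ν = ν.real s * d := fun d => by
      rw [integral_indicator_const d hs, smul_eq_mul]
    have hfun : ∀ z, (SimpleFunc.piecewise s hs (SimpleFunc.const Z c) (SimpleFunc.const Z 0)) z
        = s.indicator (fun _ => c) z := fun z => by
      by_cases hz : z ∈ s <;> simp [hz]
    simp_rw [hfun, hint]
    have hreal : ν.real s = Q (chi s hs) := by
      rw [measureReal_def, hνQ s hs, ENNReal.toReal_ofReal (hQ0 _)]
    rcases s.eq_empty_or_nonempty with rfl | ⟨z₀, hz₀⟩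
    · have h0 : (0 : ℝ) ∈ Set.Icc (0 : ℝ) 1 := ⟨le_rfl, zero_le_one⟩
      rw [hAff.map_const_mul hWA (constUF 0 h0) _ 0 h0 fun z => (hfun z).trans (by simp)]
      simp
    · have hc : c ∈ Set.Icc (0 : ℝ) 1 := by
        have := hf.2 z₀
        rwa [hfun, indicator_of_mem hz₀] at this
      rw [hAff.map_const_mul hWA (chi s hs) _ c hc fun z =>
        (hfun z).trans (by by_cases hz : z ∈ s <;> simp [chi, hz]), hreal, mul_comm]
  | @add f g hdisj ihf ihg =>
    intro hfg
    have hz : ∀ z, f z = 0 ∨ g z = 0 := fun z => by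
      by_contra! h
      exact Set.disjoint_left.1 hdisj (Function.mem_support.2 h.1) (Function.mem_support.2 h.2)
    have hval : ∀ z, f z + g z ∈ Set.Icc (0 : ℝ) 1 := hfg.2
    have hf : IsUF f := ⟨f.measurable, fun z => by
      rcases hz z with h | h
      · simp [h]
      · simpa [h] using hval z⟩
    have hg : IsUF g := ⟨g.measurable, fun z => by
      rcases hz z with h | h
      · simpa [h] using hval z
      · simp [h]⟩
    rw [hAff.map_add hWA ⟨f, hf⟩ ⟨g, hg⟩ _ fun z => rfl, ihf hf, ihg hg]
    exact (integral_add (UF.integrable ⟨f, hf⟩ ν) (UF.integrable ⟨g, hg⟩ ν)).symm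

/-- Every `f ∈ ℱ(Z)` is uniformly approximated from below by simple functions. -/
lemma UF.exists_simple_le (f : UF Z) (n : ℕ) (hn : 0 < n) :
    ∃ ψ : UF Z, (Set.range ψ.1).Finite ∧ (∀ z, ψ.1 z ≤ f.1 z) ∧
      ∀ z, f.1 z ≤ ψ.1 z + 1 / n := by
  have hn' : (0 : ℝ) < n := Nat.cast_pos.2 hn
  have hle : ∀ z, (⌊n * f.1 z⌋₊ : ℝ) / n ≤ f.1 z := fun z => by
    rw [div_le_iff₀ hn', mul_comm (f.1 z)]
    exact Nat.floor_le (mul_nonneg hn'.le (f.2.2 z).1)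
  refine ⟨⟨fun z => (⌊n * f.1 z⌋₊ : ℝ) / n, ?_, fun z =>
    ⟨by positivity, (hle z).trans (f.2.2 z).2⟩⟩, ?_, hle, fun z => ?_⟩
  · exact (measurable_from_nat.comp
      (Nat.measurable_floor.comp (f.2.1.const_mul (n : ℝ)))).div_const _
  · refine ((Set.finite_Iic n).image fun k : ℕ => (k : ℝ) / n).subset ?_
    rintro _ ⟨z, rfl⟩
    refine ⟨_, ?_, rfl⟩
    exact Nat.floor_le_of_le (mul_le_of_le_one_right hn'.le (f.2.2 z).2)
  · dsimp only
    rw [← add_div, le_div_iff₀ hn', mul_comm]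
    exact (Nat.lt_floor_add_one _).le

/-- A weakly averaging, affine, limit-preserving functional is integration against its associated
measure. -/
theorem eq_integral_of_preservesLimits (hQ0 : ∀ g, 0 ≤ Q g)
    (hWA : WeaklyAveraging Q) (hAff : IsAffineFunctional Q) (hPL : PreservesLimitsFunctional Q)
    (ν : Measure Z) [IsProbabilityMeasure ν]
    (hνQ : ∀ (E : Set Z) (hE : MeasurableSet E), ν E = ENNReal.ofReal (Q (chi E hE)))
    (f : UF Z) : Q f = ∫ z, f.1 z ∂ν := by
  have hsimple : ∀ ψ : UF Z, (Set.range ψ.1).Finite → Q ψ = ∫ z, ψ.1 z ∂ν := fun ψ hψ =>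
    hAff.eq_integral_simpleFunc hQ0 hWA ν hνQ
      ⟨ψ.1, fun x => ψ.2.1 (measurableSet_singleton x), hψ⟩ ψ.2
  have hub : ∀ r ∈ {r : ℝ | ∃ ψ : UF Z,
      (Set.range ψ.1).Finite ∧ (∀ z, ψ.1 z ≤ f.1 z) ∧ Q ψ = r}, r ≤ ∫ z, f.1 z ∂ν := by
    rintro _ ⟨ψ, hfin, hle, rfl⟩
    rw [hsimple ψ hfin]
    exact integral_mono (ψ.integrable ν) (f.integrable ν) hle
  rw [hPL f]
  refine IsLUB.csSup_eq ⟨hub, fun b hb => le_of_forall_pos_le_add fun ε hε => ?_⟩ ?_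
  · obtain ⟨n, hn⟩ := exists_nat_one_div_lt hε
    obtain ⟨ψ, hfin, hle, happ⟩ := f.exists_simple_le (n + 1) n.succ_pos
    have hψb : Q ψ ≤ b := hb ⟨ψ, hfin, hle, rfl⟩
    have hint : ∫ z, f.1 z ∂ν ≤ ∫ z, (ψ.1 z + 1 / ((n + 1 : ℕ) : ℝ)) ∂ν :=
      integral_mono (f.integrable ν) ((ψ.integrable ν).add (integrable_const _)) happ
    rw [integral_add (ψ.integrable ν) (integrable_const _), ← hsimple ψ hfin] at hint
    simp only [integral_const, probReal_univ, one_smul, Nat.cast_add, Nat.cast_one] at hint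
    linarith
  · obtain ⟨ψ, hfin, hle, -⟩ := f.exists_simple_le 1 one_pos
    exact ⟨_, ψ, hfin, hle, rfl⟩

end

/-- let `Q : ℱ(𝒯(X)) → [0,1]` be measurable, weakly averaging, affine and
limit-preserving, and let `ν` be its associated probability measure on `𝒯(X)`, i.e.
`ν(E) = Q(χ_E)` for measurable `E`.  Then for every measurable `S ⊆ X`,
`Q(ev_{χ_S}) = ∫_{𝒯(X)} G(χ_S) dν(G)`; that is, the probability measure associated to
the functional `μ_X(Q) : f ↦ Q(ev_f)` is the Giry multiplication applied to the
pushforward of `ν` along `G ↦ ν_G`:  `ν_{μ_X(Q)}(S) = ∫ ν_G(S) dν(G)`. -/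
theorem multiplication_functional_is_giry_join
    {X : Type*} [MeasurableSpace X] (Q : UF (TT X) → ℝ)
    (hQmeas : Measurable Q)
    (hQ01 : ∀ g, Q g ∈ Set.Icc (0 : ℝ) 1)
    (hWA : WeaklyAveraging Q) (hAff : IsAffineFunctional Q)
    (hPL : PreservesLimitsFunctional Q)
    (ν : Measure (TT X)) (hν : IsProbabilityMeasure ν)
    (hνQ : ∀ (E : Set (TT X)) (hE : MeasurableSet E), ν E = ENNReal.ofReal (Q (chi E hE))) :
    ∀ (S : Set X) (hS : MeasurableSet S),
      Q ⟨fun G : TT X => G.1 (chi S hS), evalUF (chi S hS)⟩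
        = ∫ G : TT X, G.1 (chi S hS) ∂ν := by
  intro S hS
  exact eq_integral_of_preservesLimits (fun g => (hQ01 g).1) hWA hAff hPL ν hνQ _
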